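/- arXiv:1304.0214 — 2 statements merged into one kernel-verified Lean document; each statement's English description precedes it below -/
import Mathlib

section
/- Let R be the ring of integers of a number field, k ≥ 2, and let g(𝔡) = μ(𝔡)/ζ_K(k) · Π_{𝔭 ⊇ 𝔡} 1/(N(𝔭^k) − 1) for squarefree ideals 𝔡, where ζ_K(k) = Π_𝔭 (1 − N(𝔭)^{−k})^{−1}. Then for every squarefree ideal 𝔟, Σ_{𝔞 ⊆ 𝔟, 𝔞 squarefree} μ(𝔞) g(𝔞) = 1/N(𝔟^k), where the sum ranges over squarefree ideals 𝔞 divisible by 𝔟. -/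
open scoped NumberField Classical

/-- The Möbius function on nonzero ideals. -/
noncomputable def idealMoebius {K : Type*} [Field K] [NumberField K] (𝔞 : Ideal (𝓞 K)) : ℤ :=
  if Squarefree 𝔞 then (-1) ^ (UniqueFactorizationMonoid.factors 𝔞).card else 0

/-- The Dedekind zeta value `ζ_K(k) = Π_𝔭 (1 - N(𝔭)^{-k})⁻¹` as an Euler product over the
nonzero prime ideals of `𝓞 K`. -/
noncomputable def zetaK (K : Type*) [Field K] [NumberField K] (k : ℕ) : ℝ :=
  ∏' 𝔭 : {𝔭 : Ideal (𝓞 K) // 𝔭.IsPrime ∧ 𝔭 ≠ ⊥},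
    (1 - ((Ideal.absNorm (𝔭 : Ideal (𝓞 K)) : ℝ))⁻¹ ^ k)⁻¹

/-- `g(𝔡) = μ(𝔡)/ζ_K(k) · Π_{𝔭 ∣ 𝔡} (N(𝔭^k) - 1)⁻¹`. -/
noncomputable def gFun {K : Type*} [Field K] [NumberField K] (k : ℕ) (𝔡 : Ideal (𝓞 K)) : ℝ :=
  (idealMoebius 𝔡 : ℝ) / zetaK K k *
    ∏' 𝔭 : {𝔭 : Ideal (𝓞 K) // 𝔭.IsPrime ∧ 𝔭 ≠ ⊥ ∧ 𝔭 ∣ 𝔡},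
      ((Ideal.absNorm ((𝔭 : Ideal (𝓞 K)) ^ k) : ℝ) - 1)⁻¹

open Filter Topology in
/-- The partial sums of the ideal counting function are `O(n)`. -/
theorem aux_bigO (K : Type*) [Field K] [NumberField K] :
    (fun n : ℕ ↦ ∑ j ∈ Finset.Icc 1 n, (Nat.card {I : Ideal (𝓞 K) // Ideal.absNorm I = j} : ℝ))
      =O[atTop] fun n : ℕ ↦ (n : ℝ) ^ (1 : ℝ) := by
  have hT := (NumberField.Ideal.tendsto_norm_le_div_atTop₀ K).comp tendsto_natCast_atTop_atTop
  have hO := hT.isBigO_one ℝ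
  have h2 := hO.mul (Asymptotics.isBigO_refl (fun n : ℕ ↦ (n : ℝ)) atTop)
  refine Asymptotics.IsBigO.congr' h2 ?_ ?_
  · filter_upwards [eventually_gt_atTop 0] with n hn
    have hn' : (n : ℝ) ≠ 0 := by positivity
    simp only [Function.comp_apply, Nat.cast_le]
    rw [div_mul_cancel₀ _ hn', ← Nat.cast_sum]
    congr 1
    rw [← add_left_inj 1, ← Ideal.card_norm_le_eq_card_norm_le_add_one,
      show Finset.Icc 1 n = Finset.Ioc 0 n from Finset.Icc_succ_left_eq_Ioc _ _,
      show 1 = Nat.card {I : Ideal (𝓞 K) // Ideal.absNorm I = 0} by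
        simp [Ideal.absNorm_eq_zero_iff],
      Finset.sum_Ioc_add_eq_sum_Icc (n.zero_le),
      ← Finset.card_preimage_eq_sum_card_image_eq
        (fun k _ ↦ Ideal.finite_setOfPred_absNorm_eq k)]
    simp [Set.coe_eq_subtype]
  · filter_upwards with n
    simp

theorem aux_summable_ideals (K : Type*) [Field K] [NumberField K] (k : ℕ) (hk : 2 ≤ k) :
    Summable (fun I : Ideal (𝓞 K) ↦ ((Ideal.absNorm I : ℝ))⁻¹ ^ k) := by
  have hL := LSeriesSummable_of_sum_norm_bigO_and_nonneg (s := (k : ℂ)) (aux_bigO K)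
    (fun n ↦ Nat.cast_nonneg _) zero_le_one (by
      have : (1 : ℝ) < k := by exact_mod_cast hk
      simpa using this)
  have hS := hL.norm
  rw [← (Equiv.sigmaFiberEquiv (fun I : Ideal (𝓞 K) ↦ Ideal.absNorm I)).summable_iff,
    summable_sigma_of_nonneg (fun x ↦ by simp only [Function.comp]; positivity)]
  refine ⟨fun n ↦ ?_, ?_⟩
  · have : Finite {I : Ideal (𝓞 K) // Ideal.absNorm I = n} :=
      (Ideal.finite_setOfPred_absNorm_eq n).to_subtype
    exact Summable.of_finite
  · refine hS.congr fun n ↦ ?_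
    have : Finite {I : Ideal (𝓞 K) // Ideal.absNorm I = n} :=
      (Ideal.finite_setOfPred_absNorm_eq n).to_subtype
    have h1 : ∀ y : {I : Ideal (𝓞 K) // Ideal.absNorm I = n},
        ((fun I : Ideal (𝓞 K) ↦ ((Ideal.absNorm I : ℝ))⁻¹ ^ k) ∘
          (Equiv.sigmaFiberEquiv (fun I : Ideal (𝓞 K) ↦ Ideal.absNorm I))) ⟨n, y⟩
          = ((n : ℝ))⁻¹ ^ k := by
      rintro ⟨I, hI⟩
      simp [Equiv.sigmaFiberEquiv, hI]
    rw [tsum_congr h1, tsum_const, nsmul_eq_mul]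
    rcases eq_or_ne n 0 with rfl | hn
    · have : k ≠ 0 := by omega
      simp [this]
    · rw [LSeries.term_of_ne_zero hn]
      simp [div_eq_mul_inv]

/-- Abstract version of the identity. -/
theorem aux_abstract {ι : Type*} (f : ι → ℝ) (hf : ∀ i, 0 ≤ f i) (hs : Summable f)
    (B : Finset ι) :
    ∑' S : {S : Finset ι // B ⊆ S}, ∏ i ∈ S.1, f i =
      (∏ i ∈ B, f i * (1 + f i)⁻¹) * ∏' i, (1 + f i) := by
  have hsum := summable_finsetProd_of_summable_nonneg hf hs
  have hprod : HasProd (fun i ↦ 1 + f i) (∏' i, (1 + f i)) :=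
    (multipliable_one_add_of_summable_prod hsum).hasProd
  have hpos : ∀ i, 1 + f i ≠ 0 := fun i ↦ by have := hf i; positivity
  have e := tsum_subtype {S : Finset ι | B ⊆ S} (fun S ↦ ∏ i ∈ S, f i)
  refine e.trans ?_
  have hs2 := hsum.indicator {S : Finset ι | B ⊆ S}
  have h3 := hs2.hasSum.comp Filter.tendsto_finset_powerset_atTop_atTop
  refine tendsto_nhds_unique h3 ?_
  have h4 := (Filter.Tendsto.const_mul (∏ i ∈ B, f i * (1 + f i)⁻¹) hprod)
  refine h4.congr' ?_
  filter_upwards [Filter.eventually_ge_atTop B] with U hU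
  have hU' : B ⊆ U := hU
  simp only [Function.comp]
  have h5 : ∑ S ∈ U.powerset, ({S : Finset ι | B ⊆ S}).indicator (fun S ↦ ∏ i ∈ S, f i) S
      = ∏ i ∈ U, (f i + if i ∈ B then 0 else 1) := by
    rw [Finset.prod_add]
    refine Finset.sum_congr rfl fun S hS ↦ ?_
    rw [Finset.mem_powerset] at hS
    by_cases hBS : B ⊆ S
    · rw [Set.indicator_of_mem (by exact hBS), Finset.prod_eq_one (s := U \ S), mul_one]
      intro i hi
      rw [if_neg]
      intro hiB
      exact (Finset.mem_sdiff.1 hi).2 (hBS hiB)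
    · rw [Set.indicator_of_notMem (by exact hBS)]
      obtain ⟨i, hiB, hiS⟩ := Finset.not_subset.1 hBS
      rw [Finset.prod_eq_zero (s := U \ S) (Finset.mem_sdiff.2 ⟨hU' hiB, hiS⟩), mul_zero]
      simp [hiB]
  rw [h5, ← Finset.prod_sdiff hU', ← Finset.prod_sdiff hU', mul_left_comm,
    ← Finset.prod_mul_distrib]
  congr 1
  · refine Finset.prod_congr rfl fun i hi ↦ ?_
    rw [if_neg (Finset.mem_sdiff.1 hi).2, add_comm]
  · refine Finset.prod_congr rfl fun i hi ↦ ?_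
    rw [if_pos hi, add_zero, mul_assoc, inv_mul_cancel₀ (hpos i), mul_one]

/-- nonzero primes -/
abbrev PP (K : Type*) [Field K] [NumberField K] := {𝔭 : Ideal (𝓞 K) // 𝔭.IsPrime ∧ 𝔭 ≠ ⊥}

section
variable {K : Type*} [Field K] [NumberField K]

theorem PP.prime (p : PP K) : Prime p.1 := Ideal.prime_of_isPrime p.2.2 p.2.1

theorem PP.dvd_iff (p q : PP K) : p.1 ∣ q.1 ↔ p = q := by
  rw [p.prime.dvd_prime_iff_associated q.prime, associated_iff_eq, Subtype.ext_iff]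

theorem PP.dvd_prod_iff (p : PP K) (S : Finset (PP K)) : p.1 ∣ ∏ q ∈ S, q.1 ↔ p ∈ S := by
  rw [p.prime.dvd_finsetProd_iff]
  constructor
  · rintro ⟨q, hq, h⟩
    rwa [(PP.dvd_iff p q).1 h]
  · exact fun h ↦ ⟨p, h, dvd_rfl⟩

theorem PP.squarefree (S : Finset (PP K)) : Squarefree (∏ q ∈ S, q.1) := by
  refine Finset.squarefree_prod_of_pairwise_isCoprime ?_ fun p _ ↦ p.prime.squarefree
  intro p _ q _ hpq
  refine (p.prime.irreducible.isRelPrime_iff_not_dvd).2 ?_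
  rwa [PP.dvd_iff]

theorem PP.exists_eq (I : Ideal (𝓞 K)) (hI : Squarefree I) :
    ∃ S : Finset (PP K), ∏ q ∈ S, q.1 = I := by
  have h0 : I ≠ 0 := hI.ne_zero
  have hn := (UniqueFactorizationMonoid.squarefree_iff_nodup_normalizedFactors h0).1 hI
  have hp := Ideal.prod_normalizedFactors_eq_self h0
  refine ⟨(UniqueFactorizationMonoid.normalizedFactors I).toFinset.subtype
    (fun 𝔭 : Ideal (𝓞 K) ↦ 𝔭.IsPrime ∧ 𝔭 ≠ ⊥), ?_⟩
  rw [Finset.prod_subtype_of_mem (fun x : Ideal (𝓞 K) ↦ x)]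
  · rw [Finset.prod_multiset_count_of_subset _ _ subset_rfl] at hp
    conv_rhs => rw [← hp]
    refine Finset.prod_congr rfl fun x hx ↦ ?_
    rw [Multiset.count_eq_one_of_mem hn (Multiset.mem_toFinset.1 hx), pow_one]
  · intro x hx
    have := UniqueFactorizationMonoid.prime_of_normalized_factor x (Multiset.mem_toFinset.1 hx)
    exact ⟨Ideal.isPrime_of_prime this, this.ne_zero⟩

theorem PP.subset_iff (B S : Finset (PP K)) : ∏ q ∈ B, q.1 ∣ ∏ q ∈ S, q.1 ↔ B ⊆ S := by
  constructor
  · intro h p hp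
    exact (PP.dvd_prod_iff p S).1 (((PP.dvd_prod_iff p B).2 hp).trans h)
  · exact fun h ↦ Finset.prod_dvd_prod_of_subset _ _ _ h

theorem PP.moebius_sq (I : Ideal (𝓞 K)) (hI : Squarefree I) :
    (idealMoebius I : ℝ) * (idealMoebius I : ℝ) = 1 := by
  rw [idealMoebius, if_pos hI]
  push_cast
  rw [← mul_pow]
  simp

/-- The equivalence of finite sets of primes with squarefree ideals. -/
noncomputable def PP.equivB (B : Finset (PP K)) :
    {S : Finset (PP K) // B ⊆ S} ≃
      {𝔞 : Ideal (𝓞 K) // Squarefree 𝔞 ∧ (∏ q ∈ B, q.1) ∣ 𝔞} :=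
  Equiv.ofBijective
    (fun S ↦ ⟨∏ q ∈ S.1, q.1, PP.squarefree S.1, (PP.subset_iff B S.1).2 S.2⟩) (by
    constructor
    · rintro ⟨S, hS⟩ ⟨T, hT⟩ h
      have h' : ∏ q ∈ S, q.1 = ∏ q ∈ T, q.1 := congrArg Subtype.val h
      refine Subtype.ext (Finset.Subset.antisymm ?_ ?_)
      · exact (PP.subset_iff S T).1 h'.dvd
      · exact (PP.subset_iff T S).1 h'.symm.dvd
    · rintro ⟨I, hI, hB⟩
      obtain ⟨S, rfl⟩ := PP.exists_eq I hI
      exact ⟨⟨S, (PP.subset_iff B S).1 hB⟩, rfl⟩)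

theorem PP.tprod_eq (S : Finset (PP K)) (F : Ideal (𝓞 K) → ℝ) :
    ∏' 𝔭 : {𝔭 : Ideal (𝓞 K) // 𝔭.IsPrime ∧ 𝔭 ≠ ⊥ ∧ 𝔭 ∣ ∏ q ∈ S, q.1}, F 𝔭 =
      ∏ p ∈ S, F p.1 := by
  let e : {p // p ∈ S} ≃ {𝔭 : Ideal (𝓞 K) // 𝔭.IsPrime ∧ 𝔭 ≠ ⊥ ∧ 𝔭 ∣ ∏ q ∈ S, q.1} :=
    { toFun := fun p ↦ ⟨p.1.1, p.1.2.1, p.1.2.2, (PP.dvd_prod_iff p.1 S).2 p.2⟩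
      invFun := fun 𝔭 ↦ ⟨⟨𝔭.1, 𝔭.2.1, 𝔭.2.2.1⟩, (PP.dvd_prod_iff ⟨𝔭.1, 𝔭.2.1, 𝔭.2.2.1⟩ S).1 𝔭.2.2.2⟩
      left_inv := fun _ ↦ rfl
      right_inv := fun _ ↦ rfl }
  rw [← e.tprod_eq]
  exact Finset.tprod_subtype S (fun p : PP K ↦ F p.1)

theorem PP.two_le (p : PP K) : (2 : ℝ) ≤ Ideal.absNorm p.1 := by
  have h0 : Ideal.absNorm p.1 ≠ 0 := fun h ↦ p.2.2 (Ideal.absNorm_eq_zero_iff.1 h)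
  have h1 : Ideal.absNorm p.1 ≠ 1 := fun h ↦ p.2.1.ne_top (Ideal.absNorm_eq_one_iff.1 h)
  exact_mod_cast (by omega : 2 ≤ Ideal.absNorm p.1)

end

theorem stmt7 (K : Type*) [Field K] [NumberField K] (k : ℕ) (hk : 2 ≤ k)
    (𝔟 : Ideal (𝓞 K)) (h𝔟 : Squarefree 𝔟) :
    ∑' 𝔞 : {𝔞 : Ideal (𝓞 K) // Squarefree 𝔞 ∧ 𝔟 ∣ 𝔞},
        (idealMoebius (𝔞 : Ideal (𝓞 K)) : ℝ) * gFun k (𝔞 : Ideal (𝓞 K)) =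
      ((Ideal.absNorm (𝔟 ^ k) : ℝ))⁻¹ := by
  obtain ⟨B, rfl⟩ := PP.exists_eq 𝔟 h𝔟
  set f : PP K → ℝ := fun p ↦ ((Ideal.absNorm (p.1 ^ k) : ℝ) - 1)⁻¹ with hfdef
  have hN : ∀ p : PP K, (2 : ℝ) ≤ (Ideal.absNorm p.1 : ℝ) ^ k := fun p ↦
    (PP.two_le p).trans (le_self_pow₀ (by linarith [PP.two_le p]) (by omega))
  have hfp : ∀ p, f p = ((Ideal.absNorm p.1 : ℝ) ^ k - 1)⁻¹ := fun p ↦ by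
    simp [hfdef, map_pow]
  have hf : ∀ p, 0 ≤ f p := fun p ↦ by
    rw [hfp]
    exact inv_nonneg.2 (by linarith [hN p])
  have h1f : ∀ p, 1 + f p = (1 - ((Ideal.absNorm p.1 : ℝ))⁻¹ ^ k)⁻¹ := fun p ↦ by
    rw [hfp, inv_pow]
    have h := hN p
    generalize (Ideal.absNorm p.1 : ℝ) ^ k = x at h
    have h1 : x - 1 ≠ 0 := by linarith
    have h2 : x ≠ 0 := by linarith
    have h3 : 1 - x⁻¹ = (x - 1) / x := by field_simp
    rw [h3, inv_div]
    field_simp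
    ring
  have hs : Summable f := by
    have h := ((aux_summable_ideals K k hk).comp_injective
      (Subtype.val_injective (p := fun 𝔭 : Ideal (𝓞 K) ↦ 𝔭.IsPrime ∧ 𝔭 ≠ ⊥))).mul_left 2
    refine Summable.of_nonneg_of_le hf (fun p ↦ ?_) h
    simp only [Function.comp]
    rw [hfp, inv_pow]
    have h := hN p
    generalize (Ideal.absNorm p.1 : ℝ) ^ k = x at h
    rw [← div_eq_mul_inv, inv_eq_one_div, div_le_div_iff₀ (by linarith) (by linarith)]
    linarith
  have hz : zetaK K k = ∏' p : PP K, (1 + f p) := by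
    rw [zetaK]
    exact tprod_congr fun p ↦ (h1f p).symm
  have hz0 : zetaK K k ≠ 0 := by
    rw [hz]
    refine tprod_one_add_ne_zero_of_summable (fun p ↦ ?_) hs.norm
    have := hf p
    positivity
  rw [← (PP.equivB B).tsum_eq]
  have hterm : ∀ S : {S : Finset (PP K) // B ⊆ S},
      (idealMoebius ((PP.equivB B S : Ideal (𝓞 K))) : ℝ) * gFun k (PP.equivB B S : Ideal (𝓞 K))
        = (∏ p ∈ S.1, f p) * (zetaK K k)⁻¹ := by
    intro S
    have hS : (PP.equivB B S : Ideal (𝓞 K)) = ∏ q ∈ S.1, q.1 := rfl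
    rw [hS, gFun, PP.tprod_eq S.1 (fun I ↦ ((Ideal.absNorm (I ^ k) : ℝ) - 1)⁻¹),
      div_eq_mul_inv, ← mul_assoc, ← mul_assoc, PP.moebius_sq _ (PP.squarefree S.1), one_mul,
      mul_comm]
  rw [tsum_congr hterm, tsum_mul_right, aux_abstract f hf hs B, ← hz, mul_assoc,
    mul_inv_cancel₀ hz0, mul_one, map_pow, map_prod, ← Finset.prod_pow]
  push_cast
  rw [← Finset.prod_inv_distrib]
  refine Finset.prod_congr rfl fun p _ ↦ ?_
  rw [h1f, hfp, inv_inv, inv_pow]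
  have h := hN p
  generalize (Ideal.absNorm p.1 : ℝ) ^ k = x at h
  have h1 : x - 1 ≠ 0 := by linarith
  have h2 : x ≠ 0 := by linarith
  field_simp
end

section
/- Let R be the ring of integers of a number field, k ≥ 2, and for squarefree ideals 𝔡 define σ_𝔡 = Σ μ(𝔟₀)μ(𝔟₁)/N(lcm(𝔟₀,𝔟₁)^k), summed over pairs of squarefree ideals 𝔟₀, 𝔟₁ with gcd(𝔟₀,𝔟₁) = 𝔡. Then σ_𝔡 = (1/N(𝔡^k)) · Π_{𝔭 ∤ 𝔡} (1 − 2/N(𝔭^k)), the product over prime ideals not dividing 𝔡. -/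
open scoped NumberField Classical

/-- The primes not dividing `𝔡`. -/
abbrev PrimesAway {K : Type*} [Field K] [NumberField K] (𝔡 : Ideal (𝓞 K)) : Type _ :=
  {𝔭 : Ideal (𝓞 K) // 𝔭.IsPrime ∧ 𝔭 ≠ ⊥ ∧ ¬ 𝔭 ∣ 𝔡}

/-- The product of a finite set of primes. -/
noncomputable abbrev primeProd {K : Type*} [Field K] [NumberField K] {𝔡 : Ideal (𝓞 K)}
    (S : Finset (PrimesAway 𝔡)) : Ideal (𝓞 K) := ∏ 𝔭 ∈ S, (𝔭 : Ideal (𝓞 K))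

section
variable {K : Type*} [Field K] [NumberField K]

theorem summable_absNorm_inv (k : ℕ) (hk : 2 ≤ k) :
    Summable (fun I : Ideal (𝓞 K) => ((Ideal.absNorm (I ^ k) : ℝ))⁻¹) := by
  have h1 : LSeriesSummable
      (fun n : ℕ => (((Nat.card {I : Ideal (𝓞 K) // Ideal.absNorm I = n} : ℕ) : ℝ) : ℂ)) (k : ℂ) := by
    refine LSeriesSummable_of_sum_norm_bigO_and_nonneg (r := 1)
      (f := fun n : ℕ => ((Nat.card {I : Ideal (𝓞 K) // Ideal.absNorm I = n} : ℕ) : ℝ))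
      ?_ (fun _ => Nat.cast_nonneg _) zero_le_one ?_
    · refine Asymptotics.isBigO_atTop_natCast_rpow_of_tendsto_div_rpow
        (a := NumberField.dedekindZeta_residue K) ?_
      simp only [Real.rpow_one]
      refine ((NumberField.Ideal.tendsto_norm_le_div_atTop₀ K).comp tendsto_natCast_atTop_atTop).congr
        fun n ↦ ?_
      simp only [Function.comp_apply, Nat.cast_le, ← Nat.cast_sum]
      congr
      rw [← add_left_inj 1, ← Ideal.card_norm_le_eq_card_norm_le_add_one,
        show Finset.Icc 1 n = Finset.Ioc 0 n from Finset.Icc_succ_left_eq_Ioc _ _,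
        show 1 = Nat.card {I : Ideal (𝓞 K) // Ideal.absNorm I = 0} by
          simp [Ideal.absNorm_eq_zero_iff],
        Finset.sum_Ioc_add_eq_sum_Icc (n.zero_le),
        ← Finset.card_preimage_eq_sum_card_image_eq
          (fun k _ ↦ Ideal.finite_setOfPred_absNorm_eq k)]
      simp [Set.coe_eq_subtype]
    · simp only [Complex.natCast_re]
      exact_mod_cast hk
  have h2 := h1.norm
  rw [← (Equiv.sigmaFiberEquiv (Ideal.absNorm : Ideal (𝓞 K) → ℕ)).summable_iff,
    summable_sigma_of_nonneg]
  · have hfin : ∀ n : ℕ, Finite {I : Ideal (𝓞 K) // Ideal.absNorm I = n} :=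
      fun n => Ideal.finite_setOfPred_absNorm_eq n
    refine ⟨fun n => ?_, ?_⟩
    · have := hfin n
      exact Summable.of_finite
    · refine h2.congr fun n => ?_
      have := hfin n
      have := Fintype.ofFinite {I : Ideal (𝓞 K) // Ideal.absNorm I = n}
      rw [tsum_fintype]
      rw [Finset.sum_congr rfl (g := fun _ => ((n : ℝ) ^ k)⁻¹)]
      · rw [LSeries.term_def]
        split_ifs with h
        · subst h
          simp [show k ≠ 0 by omega]
        · simp [div_eq_mul_inv]
      · rintro ⟨I, hI⟩ _
        simp [Equiv.sigmaFiberEquiv, hI]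
  · intro x
    simp only [Function.comp_apply]
    positivity

theorem PrimesAway.prime {𝔡 : Ideal (𝓞 K)} (p : PrimesAway 𝔡) : Prime (p : Ideal (𝓞 K)) :=
  Ideal.prime_of_isPrime p.2.2.1 p.2.1

theorem dvd_primeProd {𝔡 : Ideal (𝓞 K)} (S : Finset (PrimesAway 𝔡)) {q : Ideal (𝓞 K)}
    (hq : Prime q) : q ∣ primeProd S ↔ ∃ p ∈ S, (p : Ideal (𝓞 K)) = q := by
  constructor
  · intro h
    obtain ⟨p, hp, hd⟩ := (Prime.dvd_finsetProd_iff hq _).1 h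
    exact ⟨p, hp, (associated_iff_eq.1 (hq.associated_of_dvd p.prime hd)).symm⟩
  · rintro ⟨p, hp, rfl⟩
    exact Finset.dvd_prod_of_mem _ hp

theorem isRelPrime_of_no_prime {a b : Ideal (𝓞 K)} (ha : a ≠ 0)
    (h : ∀ q : Ideal (𝓞 K), Prime q → q ∣ a → q ∣ b → False) : IsRelPrime a b := by
  intro c hca hcb
  by_contra hc
  have hc0 : c ≠ 0 := fun h0 => ha (zero_dvd_iff.1 (h0 ▸ hca))
  obtain ⟨q, hq, hqc⟩ := WfDvdMonoid.exists_irreducible_factor hc hc0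
  exact h q hq.prime (hqc.trans hca) (hqc.trans hcb)

theorem primeProd_ne_zero {𝔡 : Ideal (𝓞 K)} (S : Finset (PrimesAway 𝔡)) : primeProd S ≠ 0 :=
  Finset.prod_ne_zero_iff.2 fun p _ => p.prime.ne_zero

theorem squarefree_mul_primeProd {𝔡 : Ideal (𝓞 K)} (h𝔡 : Squarefree 𝔡)
    (S : Finset (PrimesAway 𝔡)) : Squarefree (𝔡 * primeProd S) := by
  rw [squarefree_mul_iff]
  refine ⟨isRelPrime_of_no_prime h𝔡.ne_zero ?_, h𝔡, ?_⟩
  · intro q hq h1 h2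
    obtain ⟨p, _, rfl⟩ := (dvd_primeProd S hq).1 h2
    exact p.2.2.2 h1
  · refine Finset.squarefree_prod_of_pairwise_isCoprime ?_ fun p _ => p.prime.squarefree
    intro p _ q _ hpq
    refine isRelPrime_of_no_prime p.prime.ne_zero ?_
    intro r hr h1 h2
    apply hpq
    apply Subtype.ext
    rw [← associated_iff_eq.1 (hr.associated_of_dvd p.prime h1),
      ← associated_iff_eq.1 (hr.associated_of_dvd q.prime h2)]

theorem sup_primeProd {𝔡 : Ideal (𝓞 K)} {S T : Finset (PrimesAway 𝔡)} (h : Disjoint S T) :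
    𝔡 * primeProd S ⊔ 𝔡 * primeProd T = 𝔡 := by
  rw [← Ideal.mul_sup]
  have : primeProd S ⊔ primeProd T = ⊤ := by
    have h1 : IsRelPrime (primeProd S) (primeProd T) := by
      refine isRelPrime_of_no_prime (primeProd_ne_zero S) ?_
      intro q hq h1 h2
      obtain ⟨p, hp, rfl⟩ := (dvd_primeProd S hq).1 h1
      obtain ⟨p', hp', he⟩ := (dvd_primeProd T hq).1 h2
      obtain rfl := Subtype.ext he
      exact Finset.disjoint_left.1 h hp hp'
    have := h1 (d := primeProd S ⊔ primeProd T) (Ideal.dvd_iff_le.2 le_sup_left)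
      (Ideal.dvd_iff_le.2 le_sup_right)
    exact Ideal.isUnit_iff.1 this
  rw [this, Ideal.mul_top]

theorem absNorm_inf_primeProd {𝔡 : Ideal (𝓞 K)} (h𝔡 : Squarefree 𝔡)
    {S T : Finset (PrimesAway 𝔡)} (h : Disjoint S T) :
    𝔡 * primeProd S ⊓ 𝔡 * primeProd T = 𝔡 * (primeProd S * primeProd T) := by
  have h1 := Ideal.sup_mul_inf (𝔡 * primeProd S) (𝔡 * primeProd T)
  rw [sup_primeProd h] at h1
  apply mul_left_cancel₀ h𝔡.ne_zero
  rw [h1]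
  ring

theorem card_factors_eq (a : Ideal (𝓞 K)) : (UniqueFactorizationMonoid.factors a).card =
    (UniqueFactorizationMonoid.normalizedFactors a).card := by
  exact (Multiset.card_map _ _).symm

theorem idealMoebius_mul_primeProd {𝔡 : Ideal (𝓞 K)} (h𝔡 : Squarefree 𝔡)
    (S : Finset (PrimesAway 𝔡)) :
    idealMoebius (𝔡 * primeProd S) = idealMoebius 𝔡 * (-1) ^ S.card := by
  unfold idealMoebius
  rw [if_pos (squarefree_mul_primeProd h𝔡 S), if_pos h𝔡, ← pow_add, card_factors_eq,
    card_factors_eq, UniqueFactorizationMonoid.normalizedFactors_mul h𝔡.ne_zero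
      (primeProd_ne_zero S), Multiset.card_add, primeProd, Finset.prod_eq_multiset_prod,
    UniqueFactorizationMonoid.normalizedFactors_prod_of_prime]
  · simp
  · intro p hp
    obtain ⟨q, _, rfl⟩ := Multiset.mem_map.1 hp
    exact q.prime

theorem exists_primeProd {𝔡 b : Ideal (𝓞 K)} (hb : Squarefree b) (hd : 𝔡 ∣ b) :
    ∃ S : Finset (PrimesAway 𝔡), b = 𝔡 * primeProd S := by
  obtain ⟨c, rfl⟩ := hd
  obtain ⟨hrel, -, hc⟩ := squarefree_mul_iff.1 hb
  have hnd := (UniqueFactorizationMonoid.squarefree_iff_nodup_normalizedFactors hc.ne_zero).1 hc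
  let F : Finset (Ideal (𝓞 K)) := ⟨UniqueFactorizationMonoid.normalizedFactors c, hnd⟩
  have hF : ∀ q ∈ F, q.IsPrime ∧ q ≠ ⊥ ∧ ¬ q ∣ 𝔡 := by
    intro q hq
    have hq' : q ∈ UniqueFactorizationMonoid.normalizedFactors c := hq
    have hp := UniqueFactorizationMonoid.prime_of_normalized_factor q hq'
    refine ⟨Ideal.isPrime_of_prime hp, hp.ne_zero, fun h => ?_⟩
    exact hp.not_isUnit (hrel h (UniqueFactorizationMonoid.dvd_of_mem_normalizedFactors hq'))
  refine ⟨F.subtype _, ?_⟩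
  congr 1
  rw [primeProd, Finset.prod_subtype_of_mem (fun x => x) hF]
  conv_lhs => rw [← Ideal.prod_normalizedFactors_eq_self hc.ne_zero]
  simp [Finset.prod_eq_multiset_prod, F]

theorem primeProd_injective {𝔡 : Ideal (𝓞 K)} (h𝔡 : Squarefree 𝔡)
    {S T : Finset (PrimesAway 𝔡)} (h : 𝔡 * primeProd S = 𝔡 * primeProd T) : S = T := by
  have h := mul_left_cancel₀ h𝔡.ne_zero h
  ext p
  have key : ∀ U : Finset (PrimesAway 𝔡), p ∈ U ↔ (p : Ideal (𝓞 K)) ∣ primeProd U := by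
    intro U
    rw [dvd_primeProd U p.prime]
    exact ⟨fun h => ⟨p, h, rfl⟩, fun ⟨q, hq, he⟩ => Subtype.ext he ▸ hq⟩
  rw [key, key, h]

/-- Parametrisation of the pairs. -/
noncomputable def pairMap {𝔡 : Ideal (𝓞 K)} (h𝔡 : Squarefree 𝔡)
    (x : Σ T : Finset (PrimesAway 𝔡), {S // S ∈ T.powerset}) :
    {p : Ideal (𝓞 K) × Ideal (𝓞 K) // Squarefree p.1 ∧ Squarefree p.2 ∧ p.1 ⊔ p.2 = 𝔡} :=
  ⟨(𝔡 * primeProd x.2.1, 𝔡 * primeProd (x.1 \ x.2.1)),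
    squarefree_mul_primeProd h𝔡 _, squarefree_mul_primeProd h𝔡 _,
    sup_primeProd Finset.disjoint_sdiff⟩

theorem pairMap_bijective {𝔡 : Ideal (𝓞 K)} (h𝔡 : Squarefree 𝔡) :
    Function.Bijective (pairMap h𝔡) := by
  constructor
  · rintro ⟨T, S, hS⟩ ⟨T', S', hS'⟩ h
    have h := congrArg Subtype.val h
    simp only [pairMap, Prod.mk.injEq] at h
    have h1 := primeProd_injective h𝔡 h.1
    have h2 := primeProd_injective h𝔡 h.2
    subst h1
    have : T = T' := by
      rw [← Finset.union_sdiff_of_subset (Finset.mem_powerset.1 hS), h2,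
        Finset.union_sdiff_of_subset (Finset.mem_powerset.1 hS')]
    subst this
    rfl
  · rintro ⟨⟨b, c⟩, hb, hc, hbc⟩
    simp only at hb hc hbc
    obtain ⟨S, rfl⟩ := exists_primeProd (𝔡 := 𝔡) hb (Ideal.dvd_iff_le.2 (hbc ▸ le_sup_left))
    obtain ⟨T, rfl⟩ := exists_primeProd (𝔡 := 𝔡) hc (Ideal.dvd_iff_le.2 (hbc ▸ le_sup_right))
    have hdis : Disjoint S T := by
      rw [Finset.disjoint_left]
      intro p hp hp'
      have h1 : 𝔡 * (p : Ideal (𝓞 K)) ∣ 𝔡 := by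
        conv_rhs => rw [← hbc]
        rw [Ideal.dvd_iff_le]
        refine sup_le ?_ ?_
        · exact Ideal.dvd_iff_le.1 (mul_dvd_mul_left _ (Finset.dvd_prod_of_mem _ hp))
        · exact Ideal.dvd_iff_le.1 (mul_dvd_mul_left _ (Finset.dvd_prod_of_mem _ hp'))
      have h2 : 𝔡 * (p : Ideal (𝓞 K)) ∣ 𝔡 * 1 := by rwa [mul_one]
      exact p.prime.not_isUnit (isUnit_of_dvd_one ((mul_dvd_mul_iff_left h𝔡.ne_zero).1 h2))
    refine ⟨⟨S ∪ T, S, Finset.mem_powerset.2 Finset.subset_union_left⟩, ?_⟩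
    apply Subtype.ext
    simp only [pairMap]
    rw [Finset.union_sdiff_cancel_left hdis]

theorem pair_value {𝔡 : Ideal (𝓞 K)} (h𝔡 : Squarefree 𝔡) (k : ℕ)
    (x : Σ T : Finset (PrimesAway 𝔡), {S // S ∈ T.powerset}) :
    ((idealMoebius (pairMap h𝔡 x).1.1 : ℝ) * (idealMoebius (pairMap h𝔡 x).1.2 : ℝ)) /
        (Ideal.absNorm (((pairMap h𝔡 x).1.1 ⊓ (pairMap h𝔡 x).1.2) ^ k) : ℝ) =
      ((Ideal.absNorm (𝔡 ^ k) : ℝ))⁻¹ *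
        ∏ p ∈ x.1, (-((Ideal.absNorm ((p : Ideal (𝓞 K)) ^ k) : ℝ))⁻¹) := by
  obtain ⟨T, S, hS⟩ := x
  have hS := Finset.mem_powerset.1 hS
  simp only [pairMap]
  rw [absNorm_inf_primeProd h𝔡 Finset.disjoint_sdiff, idealMoebius_mul_primeProd h𝔡,
    idealMoebius_mul_primeProd h𝔡]
  have e1 : primeProd S * primeProd (T \ S) = primeProd T := by
    rw [mul_comm]; exact Finset.prod_sdiff hS
  have e2 : (idealMoebius 𝔡 : ℝ) * (idealMoebius 𝔡 : ℝ) = 1 := by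
    rw [idealMoebius, if_pos h𝔡]
    push_cast
    rw [← pow_add, ← two_mul, pow_mul]
    norm_num
  have e3 : (-1 : ℝ) ^ S.card * (-1) ^ (T \ S).card = (-1) ^ T.card := by
    rw [← pow_add, add_comm, Finset.card_sdiff_add_card_eq_card hS]
  have e4 : ∏ p ∈ T, (-((Ideal.absNorm ((p : Ideal (𝓞 K)) ^ k) : ℝ))⁻¹) =
      (-1) ^ T.card * ((Ideal.absNorm (primeProd T ^ k) : ℝ))⁻¹ := by
    rw [Finset.prod_neg, ← Finset.prod_pow, map_prod, Nat.cast_prod, Finset.prod_inv_distrib]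
  rw [e1, e4, ← e3, mul_pow, map_mul, Nat.cast_mul, div_eq_mul_inv, mul_inv]
  push_cast
  linear_combination ((-1 : ℝ) ^ S.card * (-1) ^ (T \ S).card *
    (((Ideal.absNorm (𝔡 ^ k) : ℝ))⁻¹ * ((Ideal.absNorm (primeProd T ^ k) : ℝ))⁻¹)) * e2

end

/-- For `k ≥ 2` and a squarefree ideal `𝔡`, the sum
`σ_𝔡 = Σ μ(𝔟₀)μ(𝔟₁)/N(lcm(𝔟₀,𝔟₁)^k)` over pairs of squarefree ideals with
`gcd(𝔟₀,𝔟₁) = 𝔟₀ + 𝔟₁ = 𝔡` converges absolutely and equals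
`(1/N(𝔡^k)) · Π_{𝔭 ∤ 𝔡} (1 - 2/N(𝔭^k))`, the product over nonzero primes not dividing `𝔡`. -/
theorem stmt8 (K : Type*) [Field K] [NumberField K] (k : ℕ) (hk : 2 ≤ k)
    (𝔡 : Ideal (𝓞 K)) (h𝔡 : Squarefree 𝔡) :
    Summable (fun p : {p : Ideal (𝓞 K) × Ideal (𝓞 K) //
        Squarefree p.1 ∧ Squarefree p.2 ∧ p.1 ⊔ p.2 = 𝔡} =>
      ((idealMoebius (p : Ideal (𝓞 K) × Ideal (𝓞 K)).1 : ℝ) *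
          (idealMoebius (p : Ideal (𝓞 K) × Ideal (𝓞 K)).2 : ℝ)) /
        (Ideal.absNorm (((p : Ideal (𝓞 K) × Ideal (𝓞 K)).1 ⊓
          (p : Ideal (𝓞 K) × Ideal (𝓞 K)).2) ^ k) : ℝ)) ∧
    ∑' p : {p : Ideal (𝓞 K) × Ideal (𝓞 K) //
        Squarefree p.1 ∧ Squarefree p.2 ∧ p.1 ⊔ p.2 = 𝔡},
      ((idealMoebius (p : Ideal (𝓞 K) × Ideal (𝓞 K)).1 : ℝ) *
          (idealMoebius (p : Ideal (𝓞 K) × Ideal (𝓞 K)).2 : ℝ)) /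
        (Ideal.absNorm (((p : Ideal (𝓞 K) × Ideal (𝓞 K)).1 ⊓
          (p : Ideal (𝓞 K) × Ideal (𝓞 K)).2) ^ k) : ℝ) =
      ((Ideal.absNorm (𝔡 ^ k) : ℝ))⁻¹ *
        ∏' 𝔭 : {𝔭 : Ideal (𝓞 K) // 𝔭.IsPrime ∧ 𝔭 ≠ ⊥ ∧ ¬ 𝔭 ∣ 𝔡},
          (1 - 2 / (Ideal.absNorm ((𝔭 : Ideal (𝓞 K)) ^ k) : ℝ)) := by
  have hs : Summable (fun 𝔭 : PrimesAway 𝔡 => ((Ideal.absNorm ((𝔭 : Ideal (𝓞 K)) ^ k) : ℝ))⁻¹) :=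
    (summable_absNorm_inv (K := K) k hk).comp_injective Subtype.val_injective
  have inner : ∀ (a : PrimesAway 𝔡 → ℝ) (T : Finset (PrimesAway 𝔡)),
      ∑' _ : {S // S ∈ T.powerset}, ∏ p ∈ T, a p = ∏ p ∈ T, 2 * a p := by
    intro a T
    rw [tsum_fintype, Finset.sum_const, Finset.card_univ, Fintype.card_coe, Finset.card_powerset,
      Finset.prod_mul_distrib, Finset.prod_const]
    simp
  have hsum : Summable (fun x : Σ T : Finset (PrimesAway 𝔡), {S // S ∈ T.powerset} =>
      ∏ p ∈ x.1, (-((Ideal.absNorm ((p : Ideal (𝓞 K)) ^ k) : ℝ))⁻¹)) := by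
    apply Summable.of_norm
    rw [summable_sigma_of_nonneg (fun _ => norm_nonneg _)]
    refine ⟨fun T => Summable.of_finite, ?_⟩
    simp only [norm_prod]
    simp only [inner (fun p => ‖(-((Ideal.absNorm ((p : Ideal (𝓞 K)) ^ k) : ℝ))⁻¹)‖)]
    apply summable_finsetProd_of_summable_norm
    refine (hs.mul_left 2).congr fun p => ?_
    simp
  let e := Equiv.ofBijective (pairMap h𝔡) (pairMap_bijective h𝔡)
  constructor
  · rw [← e.summable_iff]
    refine (hsum.mul_left ((Ideal.absNorm (𝔡 ^ k) : ℝ))⁻¹).congr fun x => ?_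
    exact (pair_value h𝔡 k x).symm
  · rw [← e.tsum_eq]
    refine (tsum_congr (fun x => pair_value h𝔡 k x)).trans ?_
    rw [tsum_mul_left]
    congr 1
    rw [hsum.tsum_sigma]
    simp only [inner (fun p => (-((Ideal.absNorm ((p : Ideal (𝓞 K)) ^ k) : ℝ))⁻¹))]
    rw [← tprod_one_add]
    · refine tprod_congr fun p => ?_
      ring
    · apply summable_finsetProd_of_summable_norm
      refine (hs.mul_left 2).congr fun p => ?_
      simp
end
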